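/- Termination of turn-based value-set iteration (Lemma 5.2): Assume the stochastic game is c-turn-based and consider its λ-memory meta-game. Define the sequence of value-set functions over meta-states by 𝒱^0(𝐱) = neigh_{ξ/2}(B) for every meta-state 𝐱 and 𝒱^{k+1} = Φ^TB(𝒱^k). Then the sequence is decreasing, there exists K ≤ |S|^{λ+1}·(2/ξ + 2)^{(λ+1)·c} with 𝒱^{K+1} = 𝒱^K, and the resulting 𝒱 = 𝒱^K satisfies 𝒱 = Φ^TB(𝒱) and 𝒱(𝐱) ⊇ 𝒱*(𝐱) for every meta-state 𝐱, where 𝒱* is the inducible value set of the meta-game. -/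

import Mathlib

open Finset

/-- A probability mass function on a finite type, as a predicate. -/
def IsDist {X : Type*} [Fintype X] (f : X → ℝ) : Prop :=
  (∀ x, 0 ≤ f x) ∧ ∑ x, f x = 1

/-- Data of a stochastic game with a principal (player `0`) and `n` agents
(players `1,…,n`): initial state, discount factor, transition function and
reward functions. -/
structure Game (S A : Type*) (n : ℕ) where
  sInit : S
  gamma : ℝ
  p : S → (Fin (n + 1) → A) → S → ℝ
  r : Fin (n + 1) → S → (Fin (n + 1) → A) → ℝ

/-- Validity of the game data: `γ ∈ [0,1)`, transitions are probability
distributions, and rewards lie in `[-(1-γ)/2, (1-γ)/2]`. -/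
def Game.Valid {S A : Type*} [Fintype S] {n : ℕ} (G : Game S A n) : Prop :=
  0 ≤ G.gamma ∧ G.gamma < 1 ∧ (∀ s a, IsDist (G.p s a)) ∧
    ∀ i s a, |G.r i s a| ≤ (1 - G.gamma) / 2

/-- Histories: finite sequences of (state, recommended joint action, played joint action). -/
abbrev Hist (S A : Type*) (n : ℕ) :=
  List (S × (Fin (n + 1) → A) × (Fin (n + 1) → A))

/-- A (history-dependent) correlation policy assigns a probability distribution on
joint actions to every history and current state. -/
def IsPolicy {S A : Type*} [Fintype A] {n : ℕ}
    (π : Hist S A n → S → (Fin (n + 1) → A) → ℝ) : Prop :=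
  ∀ σ s, IsDist (π σ s)

/-- The trivial deviation plan (no deviation). -/
def noDev {S A : Type*} {n : ℕ} : Hist S A n → S → A → A := fun _ _ a => a

/-- `IsValueFn G π i ρ V Q` says that `V` and `Q` are bounded functions satisfying
the Bellman-type recursion defining the V- and Q-values induced by the policy `π`
together with the deviation plan `ρ` of agent `i`. -/
def IsValueFn {S A : Type*} [Fintype S] [Fintype A] {n : ℕ}
    (G : Game S A n) (π : Hist S A n → S → (Fin (n + 1) → A) → ℝ)
    (i : Fin (n + 1)) (ρ : Hist S A n → S → A → A)
    (V : Hist S A n → S → Fin (n + 1) → ℝ)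
    (Q : Hist S A n → S → (Fin (n + 1) → A) → Fin (n + 1) → ℝ) : Prop :=
  (∃ C : ℝ, ∀ σ s j, |V σ s j| ≤ C) ∧
  (∀ σ s j, V σ s j = ∑ a : Fin (n + 1) → A, π σ s a * Q σ s a j) ∧
  (∀ σ s (a : Fin (n + 1) → A) j,
    Q σ s a j =
      G.r j s (Function.update a i (ρ σ s (a i))) +
        G.gamma * ∑ s', G.p s (Function.update a i (ρ σ s (a i))) s' *
          V (σ ++ [(s, a, Function.update a i (ρ σ s (a i)))]) s' j)

/-- `π` is a `δ`-correlated equilibrium: it is a policy, and for every agent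
`i ∈ {1,…,n}`, every history, state and recommended action, no deviation plan
improves the agent's conditional value by more than `δ`. -/
def IsCE {S A : Type*} [Fintype S] [Fintype A] [DecidableEq A] {n : ℕ}
    (G : Game S A n) (δ : ℝ)
    (π : Hist S A n → S → (Fin (n + 1) → A) → ℝ) : Prop :=
  IsPolicy π ∧
  ∀ V Q, IsValueFn G π 0 noDev V Q →
    ∀ i : Fin (n + 1), i ≠ 0 →
      ∀ (ρ : Hist S A n → S → A → A) Vρ Qρ, IsValueFn G π i ρ Vρ Qρ →
        ∀ (σ : Hist S A n) (s : S) (a : A),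
          ∑ av ∈ univ.filter (fun av : Fin (n + 1) → A => av i = a),
              π σ s av * Q σ s av i ≥
            ∑ av ∈ univ.filter (fun av : Fin (n + 1) → A => av i = a),
              π σ s av * Qρ σ s av i - δ

/-- A value vector `v` is `δ`-inducible at state `s` if `v = V^π(s)` for some `δ`-CE `π`. -/
def Inducible {S A : Type*} [Fintype S] [Fintype A] [DecidableEq A] {n : ℕ}
    (G : Game S A n) (δ : ℝ) (s : S) (v : Fin (n + 1) → ℝ) : Prop :=
  ∃ π V Q, IsCE G δ π ∧ IsValueFn G π 0 noDev V Q ∧ V [] s = v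

/-- The inducible value set `𝒱*(s)`: all values inducible (by exact CEs) at `s`. -/
def Vstar {S A : Type*} [Fintype S] [Fintype A] [DecidableEq A] {n : ℕ}
    (G : Game S A n) : S → Set (Fin (n + 1) → ℝ) :=
  fun s => {v | Inducible G 0 s v}

/-- One-step Bellman value of a stage distribution `pb` and onward values `w`. -/
def Bellman {S A : Type*} [Fintype S] [Fintype A] {n : ℕ}
    (G : Game S A n) (s : S) (pb : (Fin (n + 1) → A) → ℝ)
    (w : (Fin (n + 1) → A) → (Fin (n + 1) → A) → S → Fin (n + 1) → ℝ) :
    Fin (n + 1) → ℝ :=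
  fun j => ∑ a : Fin (n + 1) → A,
    pb a * (G.r j s a + G.gamma * ∑ s', G.p s a s' * w a a s' j)

/-- The incentive-compatibility constraint for a stage distribution `pb` and
onward values `w` at state `s`. -/
def ICC {S A : Type*} [Fintype S] [Fintype A] [DecidableEq A] {n : ℕ}
    (G : Game S A n) (s : S) (pb : (Fin (n + 1) → A) → ℝ)
    (w : (Fin (n + 1) → A) → (Fin (n + 1) → A) → S → Fin (n + 1) → ℝ) : Prop :=
  ∀ i : Fin (n + 1), i ≠ 0 → ∀ a b : A,
    ∑ av ∈ univ.filter (fun av : Fin (n + 1) → A => av i = a),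
        pb av * (G.r i s av + G.gamma * ∑ s', G.p s av s' * w av av s' i) ≥
      ∑ av ∈ univ.filter (fun av : Fin (n + 1) → A => av i = a),
        pb av * (G.r i s (Function.update av i b) +
          G.gamma * ∑ s', G.p s (Function.update av i b) s' *
            w av (Function.update av i b) s' i)

/-- The feasible set `F_s(𝒱)` of pairs `(pb, w)`. -/
def Feas {S A : Type*} [Fintype S] [Fintype A] [DecidableEq A] {n : ℕ}
    (G : Game S A n) (s : S) (VS : S → Set (Fin (n + 1) → ℝ)) :
    Set (((Fin (n + 1) → A) → ℝ) ×
      ((Fin (n + 1) → A) → (Fin (n + 1) → A) → S → Fin (n + 1) → ℝ)) :=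
  {pw | IsDist pw.1 ∧ ICC G s pw.1 pw.2 ∧ ∀ a b s', pw.2 a b s' ∈ VS s'}

/-- The update map `Φ` on value-set functions. -/
def Phi {S A : Type*} [Fintype S] [Fintype A] [DecidableEq A] {n : ℕ}
    (G : Game S A n) (VS : S → Set (Fin (n + 1) → ℝ)) :
    S → Set (Fin (n + 1) → ℝ) :=
  fun s => {v | ∃ pb w, (pb, w) ∈ Feas G s VS ∧ v = Bellman G s pb w}

/-- The hypercube `B = [-1/2, 1/2]^{n+1}`. -/
def cube (n : ℕ) : Set (Fin (n + 1) → ℝ) := {v | ∀ i, |v i| ≤ 1 / 2}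

/-- The `ξ`-neighborhood (in `‖·‖_∞`) of a set of value vectors. -/
def neigh {n : ℕ} (ξ : ℝ) (X : Set (Fin (n + 1) → ℝ)) : Set (Fin (n + 1) → ℝ) :=
  {v' | ∃ v ∈ X, ∀ i, |v' i - v i| ≤ ξ}

/-- The grid `G_ξ` of vectors whose coordinates are integer multiples of `ξ`. -/
def grid (n : ℕ) (ξ : ℝ) : Set (Fin (n + 1) → ℝ) :=
  {v | ∀ i, ∃ m : ℤ, v i = ξ * (m : ℝ)}

/-- The approximate update map `Φ̂`. -/
def PhiHat {S A : Type*} [Fintype S] [Fintype A] [DecidableEq A] {n : ℕ}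
    (G : Game S A n) (ξ : ℝ) (VS : S → Set (Fin (n + 1) → ℝ)) :
    S → Set (Fin (n + 1) → ℝ) :=
  fun s => convexHull ℝ (neigh ξ (Phi G VS s) ∩ grid n ξ)

/-- Pushing a new state into a `λ`-step memory. -/
def shiftMem {S : Type*} {lam : ℕ} (m : Fin lam → Option S) (s : S) :
    Fin lam → Option S :=
  fun j => if (j : ℕ) = 0 then some s
    else m ⟨(j : ℕ) - 1, lt_of_le_of_lt (Nat.sub_le _ _) j.isLt⟩

/-- The `λ`-memory meta-game: meta-states record the current state together with
the previous `λ` states (with `none` as placeholder). -/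
def metaGame {S A : Type*} [DecidableEq S] {n : ℕ} (G : Game S A n) (lam : ℕ) :
    Game ((Fin lam → Option S) × S) A n where
  sInit := (fun _ => none, G.sInit)
  gamma := G.gamma
  p := fun x a x' => if x'.1 = shiftMem x.1 x.2 then G.p x.2 a x'.2 else 0
  r := fun i x a => G.r i x.2 a

/-- The game is `c`-turn-based with acting-player sets `I s` (always containing
the principal `0`): rewards and transitions only depend on acting players' actions. -/
def TurnBased {S A : Type*} {n : ℕ} (G : Game S A n) (c : ℕ)
    (I : S → Finset (Fin (n + 1))) : Prop :=
  (∀ s, (I s).card ≤ c) ∧ (∀ s, (0 : Fin (n + 1)) ∈ I s) ∧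
    ∀ s (a a' : Fin (n + 1) → A), (∀ i ∈ I s, a i = a' i) →
      (∀ j, G.r j s a = G.r j s a') ∧ ∀ s', G.p s a s' = G.p s a' s'

/-- The set of acting players recorded in a meta-state. -/
def metaI {S : Type*} {n lam : ℕ} (I : S → Finset (Fin (n + 1)))
    (x : (Fin lam → Option S) × S) : Finset (Fin (n + 1)) :=
  I x.2 ∪ Finset.univ.biUnion fun j : Fin lam => (x.1 j).elim ∅ I

/-- The relaxed neighborhood `neigh_{ξ₂}^{Ix}`: coordinates in `Ix` must stay
`ξ₂`-close, the others are only required to lie in `neigh_{ξ₂}(B)`. -/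
def neighI {n : ℕ} (ξ₂ : ℝ) (Ix : Finset (Fin (n + 1)))
    (X : Set (Fin (n + 1) → ℝ)) : Set (Fin (n + 1) → ℝ) :=
  {v' | v' ∈ neigh ξ₂ (cube n) ∧ ∃ v ∈ X, ∀ i ∈ Ix, |v' i - v i| ≤ ξ₂}

/-- The turn-based approximate update map `Φ^TB` on value-set functions of the
`λ`-memory meta-game. -/
def PhiTB {S A : Type*} [Fintype S] [Fintype A] [DecidableEq S] [DecidableEq A]
    {n : ℕ} (G : Game S A n) (lam : ℕ) (I : S → Finset (Fin (n + 1))) (ξ : ℝ)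
    (VS : ((Fin lam → Option S) × S) → Set (Fin (n + 1) → ℝ)) :
    ((Fin lam → Option S) × S) → Set (Fin (n + 1) → ℝ) :=
  fun x => convexHull ℝ
    (neighI (ξ / 2) (metaI I x) (Phi (metaGame G lam) VS x) ∩ grid n (ξ / 2))

/-- The auxiliary value function of the repeated 2×2 zero-sum subgame. -/
noncomputable def vfun (x y : ℝ) : ℝ :=
  (x * y + 2 * (1 - x) * (1 - y)) / (1 - x * y / 2 - (1 - x) * (1 - y) / 2)

theorem IsDist.abs_sum_le {X : Type*} [Fintype X] {p : X → ℝ} (hp : IsDist p) {f : X → ℝ}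
    {C : ℝ} (hf : ∀ x, |f x| ≤ C) : |∑ x, p x * f x| ≤ C := by
  calc |∑ x, p x * f x| ≤ ∑ x, |p x * f x| := abs_sum_le_sum_abs _ _
    _ ≤ ∑ x, p x * C := by
        refine sum_le_sum fun x _ => ?_
        rw [abs_mul, abs_of_nonneg (hp.1 x)]
        exact mul_le_mul_of_nonneg_left (hf x) (hp.1 x)
    _ = C := by rw [← sum_mul, hp.2, one_mul]

section Values

variable {S A : Type*} [Fintype S] {n : ℕ} {G : Game S A n}

/-- One-step lookahead preserves a bound `1 / 2 + D`, shrinking the excess `D` by `γ`. -/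
theorem Game.Valid.abs_lookahead_le (hG : G.Valid) {D : ℝ} (s : S) (a : Fin (n + 1) → A)
    (j : Fin (n + 1)) {w : S → ℝ} (hw : ∀ s', |w s'| ≤ 1 / 2 + D) :
    |G.r j s a + G.gamma * ∑ s', G.p s a s' * w s'| ≤ 1 / 2 + G.gamma * D := by
  obtain ⟨hγ0, -, hp, hr⟩ := hG
  have h1 := (hp s a).abs_sum_le hw
  have h2 := hr j s a
  calc _ ≤ |G.r j s a| + |G.gamma * ∑ s', G.p s a s' * w s'| := abs_add_le _ _
    _ ≤ (1 - G.gamma) / 2 + G.gamma * (1 / 2 + D) := by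
        rw [abs_mul, abs_of_nonneg hγ0]
        gcongr
    _ = _ := by ring

theorem metaGame_valid [DecidableEq S] (hG : G.Valid) (lam : ℕ) :
    (metaGame G lam).Valid := by
  obtain ⟨h0, h1, hp, hr⟩ := hG
  refine ⟨h0, h1, fun x a => ⟨fun x' => ?_, ?_⟩, fun i x a => hr i x.2 a⟩
  · simp only [metaGame]
    split_ifs
    exacts [(hp _ _).1 _, le_rfl]
  · simp only [metaGame, Fintype.sum_prod_type]
    rw [sum_comm]
    simpa using (hp x.2 a).2

variable [Fintype A]

theorem IsValueFn.abs_le_half (hG : G.Valid) {π : Hist S A n → S → (Fin (n + 1) → A) → ℝ}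
    (hπ : IsPolicy π) {i : Fin (n + 1)} {ρ : Hist S A n → S → A → A}
    {V : Hist S A n → S → Fin (n + 1) → ℝ}
    {Q : Hist S A n → S → (Fin (n + 1) → A) → Fin (n + 1) → ℝ}
    (h : IsValueFn G π i ρ V Q) (σ : Hist S A n) (s : S) (j : Fin (n + 1)) :
    |V σ s j| ≤ 1 / 2 := by
  obtain ⟨⟨C, hC⟩, hV, hQ⟩ := h
  have key : ∀ k : ℕ, ∀ σ s j, |V σ s j| ≤ 1 / 2 + G.gamma ^ k * C := by
    intro k
    induction k with
    | zero => intro σ s j; have := hC σ s j; simp only [pow_zero, one_mul]; linarith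
    | succ k ih =>
      intro σ s j
      rw [hV]
      refine (hπ σ s).abs_sum_le fun a => ?_
      rw [hQ, pow_succ', mul_assoc]
      exact hG.abs_lookahead_le _ _ _ fun s' => ih _ s' j
  have hlim : Filter.Tendsto (fun k : ℕ => 1 / 2 + G.gamma ^ k * C) Filter.atTop
      (nhds (1 / 2)) := by
    have := ((tendsto_pow_atTop_nhds_zero_of_lt_one hG.1 hG.2.1).mul_const C).const_add (1 / 2)
    rwa [zero_mul, add_zero] at this
  exact ge_of_tendsto' hlim fun k => key k σ s j

/-- Not deviating gives the same value functions whichever agent is named as the deviator. -/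
theorem IsValueFn.noDev_change {π : Hist S A n → S → (Fin (n + 1) → A) → ℝ}
    {i : Fin (n + 1)} (i' : Fin (n + 1)) {V : Hist S A n → S → Fin (n + 1) → ℝ}
    {Q : Hist S A n → S → (Fin (n + 1) → A) → Fin (n + 1) → ℝ}
    (h : IsValueFn G π i noDev V Q) : IsValueFn G π i' noDev V Q := by
  simpa [IsValueFn, noDev] using h

/-- Functions satisfying the value recursion at every nonempty history extend to value
functions by one step of backward induction at the empty history. -/
theorem exists_isValueFn_of_ne_nil (G : Game S A n)
    (π : Hist S A n → S → (Fin (n + 1) → A) → ℝ)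
    (i : Fin (n + 1)) (ρ : Hist S A n → S → A → A)
    (V : Hist S A n → S → Fin (n + 1) → ℝ)
    (Q : Hist S A n → S → (Fin (n + 1) → A) → Fin (n + 1) → ℝ)
    (hC : ∃ C : ℝ, ∀ σ s j, |V σ s j| ≤ C)
    (hV : ∀ σ, σ ≠ [] → ∀ s j, V σ s j = ∑ a : Fin (n + 1) → A, π σ s a * Q σ s a j)
    (hQ : ∀ σ, σ ≠ [] → ∀ s (a : Fin (n + 1) → A) j,
      Q σ s a j =
        G.r j s (Function.update a i (ρ σ s (a i))) +
          G.gamma * ∑ s', G.p s (Function.update a i (ρ σ s (a i))) s' *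
            V (σ ++ [(s, a, Function.update a i (ρ σ s (a i)))]) s' j) :
    ∃ V' Q', IsValueFn G π i ρ V' Q' ∧ (∀ σ, σ ≠ [] → V' σ = V σ) ∧
      (∀ σ, σ ≠ [] → Q' σ = Q σ) := by
  classical
  let Q0 : S → (Fin (n + 1) → A) → Fin (n + 1) → ℝ := fun s a j =>
    G.r j s (Function.update a i (ρ [] s (a i))) +
      G.gamma * ∑ s', G.p s (Function.update a i (ρ [] s (a i))) s' *
        V [(s, a, Function.update a i (ρ [] s (a i)))] s' j
  let V0 : S → Fin (n + 1) → ℝ := fun s j => ∑ a, π [] s a * Q0 s a j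
  refine ⟨fun σ => if σ = [] then V0 else V σ, fun σ => if σ = [] then Q0 else Q σ,
    ⟨?_, ?_, ?_⟩, fun σ h => if_neg h, fun σ h => if_neg h⟩
  · obtain ⟨C, hC⟩ := hC
    obtain ⟨D, hD⟩ := (Set.finite_range fun x : S × Fin (n + 1) => |V0 x.1 x.2|).bddAbove
    refine ⟨max C D, fun σ s j => ?_⟩
    by_cases h : σ = []
    · simp only [h, if_true]
      exact (hD ⟨(s, j), rfl⟩).trans (le_max_right _ _)
    · simp only [h, if_false]
      exact (hC σ s j).trans (le_max_left _ _)
  · intro σ s j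
    by_cases h : σ = []
    · subst h; simp [V0]
    · simp only [h, if_false]; exact hV σ h s j
  · intro σ s a j
    by_cases h : σ = []
    · subst h; simp [Q0]
    · simpa [h] using hQ σ h s a j

/-- Value functions of a continuation policy are restrictions of value functions of the whole
policy, for the deviation plan that only deviates within that continuation. -/
theorem exists_isValueFn_extend [DecidableEq (S × (Fin (n + 1) → A) × (Fin (n + 1) → A))]
    {π : Hist S A n → S → (Fin (n + 1) → A) → ℝ} {i : Fin (n + 1)}
    {V : Hist S A n → S → Fin (n + 1) → ℝ}
    {Q : Hist S A n → S → (Fin (n + 1) → A) → Fin (n + 1) → ℝ}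
    (hVQ : IsValueFn G π i noDev V Q)
    (t : S × (Fin (n + 1) → A) × (Fin (n + 1) → A))
    {ρ : Hist S A n → S → A → A} {V₁ : Hist S A n → S → Fin (n + 1) → ℝ}
    {Q₁ : Hist S A n → S → (Fin (n + 1) → A) → Fin (n + 1) → ℝ}
    (h₁ : IsValueFn G (fun σ => π (t :: σ)) i ρ V₁ Q₁) :
    ∃ V' Q', IsValueFn G π i
        (fun σ => if σ.head? = some t then ρ σ.tail else noDev σ) V' Q' ∧
      ∀ σ, Q' (t :: σ) = Q₁ σ := by
  refine (exists_isValueFn_of_ne_nil G π i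
      (fun σ => if σ.head? = some t then ρ σ.tail else noDev σ)
      (fun σ => if σ.head? = some t then V₁ σ.tail else V σ)
      (fun σ => if σ.head? = some t then Q₁ σ.tail else Q σ) ?_ ?_ ?_).imp
    fun V' ⟨Q', h', _, hQ'⟩ =>
      ⟨Q', h', fun σ => by rw [hQ' (t :: σ) (List.cons_ne_nil _ _)]; simp⟩
  · obtain ⟨⟨C, hC⟩, -⟩ := hVQ
    obtain ⟨⟨D, hD⟩, -⟩ := h₁
    refine ⟨max C D, fun σ s j => ?_⟩
    split_ifs
    · exact (hD _ s j).trans (le_max_right _ _)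
    · exact (hC σ s j).trans (le_max_left _ _)
  · rintro (_ | ⟨u, σ⟩) hσ s j
    · exact absurd rfl hσ
    · by_cases hu : u = t
      · subst hu; simpa using h₁.2.1 σ s j
      · simpa [hu] using hVQ.2.1 (u :: σ) s j
  · rintro (_ | ⟨u, σ⟩) hσ s a j
    · exact absurd rfl hσ
    · by_cases hu : u = t
      · subst hu; simpa using h₁.2.2 σ s a j
      · simpa [hu] using hVQ.2.2 (u :: σ) s a j

/-- A continuation of a correlated equilibrium is a correlated equilibrium. -/
theorem IsCE.cons [DecidableEq A] {δ : ℝ}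
    {π : Hist S A n → S → (Fin (n + 1) → A) → ℝ} (h : IsCE G δ π)
    {V : Hist S A n → S → Fin (n + 1) → ℝ}
    {Q : Hist S A n → S → (Fin (n + 1) → A) → Fin (n + 1) → ℝ}
    (hVQ : IsValueFn G π 0 noDev V Q)
    (t : S × (Fin (n + 1) → A) × (Fin (n + 1) → A)) :
    IsCE G δ fun σ => π (t :: σ) := by
  classical
  refine ⟨fun σ s => h.1 _ s, fun V₁ Q₁ h₁ i hi ρ Vρ Qρ hρ σ s a => ?_⟩
  obtain ⟨V', Q', h', hQ'⟩ := exists_isValueFn_extend hVQ t h₁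
  obtain ⟨Vd, Qd, hd, hQd⟩ := exists_isValueFn_extend (hVQ.noDev_change i) t hρ
  have hno : (fun σ : Hist S A n => if σ.head? = some t then noDev σ.tail else noDev σ)
      = (noDev : Hist S A n → S → A → A) := by
    funext σ; split_ifs <;> rfl
  rw [hno] at h'
  have := h.2 V' Q' h' i hi _ Vd Qd hd (t :: σ) s a
  rwa [hQ', hQd] at this

/-- Inducible values decompose into inducible onward values. -/
theorem Vstar_subset_Phi [DecidableEq A] (G : Game S A n) (s : S) :
    Vstar G s ⊆ Phi G (Vstar G) s := by
  rintro v ⟨π, V, Q, hCE, hVQ, rfl⟩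
  have hQ : ∀ s a j, Q [] s a j =
      G.r j s a + G.gamma * ∑ s', G.p s a s' * V [(s, a, a)] s' j := by
    intro s a j
    simpa [noDev] using hVQ.2.2 [] s a j
  refine ⟨π [] s, fun a b s' => V [(s, a, b)] s', ⟨hCE.1 [] s, ?_, ?_⟩, ?_⟩
  · intro i hi a b
    obtain ⟨V', Q', h', hV', -⟩ := exists_isValueFn_of_ne_nil G π i
      (fun σ _ a' => if σ = [] then b else a') V Q hVQ.1 (fun σ _ => hVQ.2.1 σ) (by
        intro σ hσ s a j
        simpa [hσ, noDev] using hVQ.2.2 σ s a j)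
    have := hCE.2 V Q hVQ i hi _ V' Q' h' [] s a
    have hQ' : ∀ av, Q' [] s av i = G.r i s (Function.update av i b) +
        G.gamma * ∑ s', G.p s (Function.update av i b) s' *
          V [(s, av, Function.update av i b)] s' i := by
      intro av
      simpa [hV'] using h'.2.2 [] s av i
    simpa only [hQ, hQ', sub_zero] using this
  · intro a b s'
    refine ⟨fun σ => π ((s, a, b) :: σ), fun σ => V ((s, a, b) :: σ),
      fun σ => Q ((s, a, b) :: σ), hCE.cons hVQ _, ⟨?_, ?_, ?_⟩, rfl⟩
    · obtain ⟨C, hC⟩ := hVQ.1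
      exact ⟨C, fun σ => hC _⟩
    · exact fun σ => hVQ.2.1 _
    · exact fun σ => hVQ.2.2 _
  · funext j
    simp only [Bellman, ← hQ]
    exact hVQ.2.1 [] s j

theorem Vstar_subset_cube [DecidableEq A] (hG : G.Valid) (s : S) : Vstar G s ⊆ cube n := by
  rintro v ⟨π, V, Q, hCE, hVQ, rfl⟩ i
  exact hVQ.abs_le_half hG hCE.1 [] s i

theorem Phi_mono [DecidableEq A] {VS VS' : S → Set (Fin (n + 1) → ℝ)}
    (h : ∀ s, VS s ⊆ VS' s) (s : S) : Phi G VS s ⊆ Phi G VS' s := by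
  rintro v ⟨pb, w, ⟨h1, h2, h3⟩, rfl⟩
  exact ⟨pb, w, ⟨h1, h2, fun a b s' => h s' (h3 a b s')⟩, rfl⟩

end Values

theorem mem_neigh_cube_iff {n : ℕ} {h : ℝ} (hh : 0 ≤ h) {v : Fin (n + 1) → ℝ} :
    v ∈ neigh h (cube n) ↔ ∀ i, |v i| ≤ 1 / 2 + h := by
  constructor
  · rintro ⟨u, hu, hvu⟩ i
    have h1 := abs_le.1 (hu i)
    have h2 := abs_le.1 (hvu i)
    exact abs_le.2 ⟨by linarith [h1.1, h2.1], by linarith [h1.2, h2.2]⟩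
  · intro hv
    refine ⟨fun i => max (-(1 / 2)) (min (1 / 2) (v i)), fun i => ?_, fun i => ?_⟩
    · exact abs_le.2 ⟨le_max_left _ _, max_le (by norm_num) (min_le_left _ _)⟩
    · have := abs_le.1 (hv i)
      simp only [abs_le]
      rcases le_total (1 / 2) (v i) with h1 | h1
      · rw [min_eq_left h1, max_eq_right (by norm_num)]
        constructor <;> linarith
      · rw [min_eq_right h1]
        rcases le_total (-(1 / 2)) (v i) with h2 | h2
        · rw [max_eq_right h2]; constructor <;> linarith
        · rw [max_eq_left h2]; constructor <;> linarith

theorem convex_neigh_cube {n : ℕ} {h : ℝ} (hh : 0 ≤ h) : Convex ℝ (neigh h (cube n)) := by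
  have : neigh h (cube n) =
      Set.univ.pi fun _ : Fin (n + 1) => Set.Icc (-(1 / 2 + h)) (1 / 2 + h) := by
    ext v
    simp only [mem_neigh_cube_iff hh, abs_le, Set.mem_pi, Set.mem_univ, true_imp_iff, Set.mem_Icc]
  rw [this]
  exact convex_pi fun _ _ => convex_Icc _ _

theorem neighI_mono {n : ℕ} {h : ℝ} {J : Finset (Fin (n + 1))} {X Y : Set (Fin (n + 1) → ℝ)}
    (hXY : X ⊆ Y) : neighI h J X ⊆ neighI h J Y :=
  fun _ ⟨h1, u, hu, h2⟩ => ⟨h1, u, hXY hu, h2⟩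

/-- A point of the enlarged cube is a convex combination of the vertices of its grid cell. -/
theorem subset_convexHull_neighI_grid {n : ℕ} {h : ℝ} (hh : 0 < h) {N : ℕ}
    (hN : 1 / 2 + h = h * N) (J : Finset (Fin (n + 1))) {X : Set (Fin (n + 1) → ℝ)}
    (hX : X ⊆ neigh h (cube n)) : X ⊆ convexHull ℝ (neighI h J X ∩ grid n h) := by
  intro v hv
  have hb := (mem_neigh_cube_iff hh.le).1 (hX hv)
  have hlo : ∀ i, h * ⌊v i / h⌋ ≤ v i := fun i => by
    have := (le_div_iff₀ hh).1 (Int.floor_le (v i / h)); linarith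
  have hlo' : ∀ i, v i - h ≤ h * ⌊v i / h⌋ := fun i => by
    have := (div_lt_iff₀ hh).1 (Int.lt_floor_add_one (v i / h)); linarith
  have hhi : ∀ i, v i ≤ h * ⌈v i / h⌉ := fun i => by
    have := (div_le_iff₀ hh).1 (Int.le_ceil (v i / h)); linarith
  have hhi' : ∀ i, h * ⌈v i / h⌉ ≤ v i + h := fun i => by
    have := (lt_div_iff₀ hh).1 (sub_lt_iff_lt_add.2 (Int.ceil_lt_add_one (v i / h))); linarith
  have hloN : ∀ i, -(h * N) ≤ h * ⌊v i / h⌋ := fun i => by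
    have : (-(N : ℤ)) ≤ ⌊v i / h⌋ := by
      rw [Int.le_floor, le_div_iff₀ hh]
      push_cast
      linarith [(abs_le.1 (hb i)).1]
    have : (-(N : ℝ)) ≤ ⌊v i / h⌋ := by exact_mod_cast this
    nlinarith
  have hhiN : ∀ i, h * ⌈v i / h⌉ ≤ h * N := fun i => by
    have : ⌈v i / h⌉ ≤ (N : ℤ) := by
      rw [Int.ceil_le, div_le_iff₀ hh]
      push_cast
      linarith [(abs_le.1 (hb i)).2]
    have : (⌈v i / h⌉ : ℝ) ≤ N := by exact_mod_cast this
    nlinarith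
  have hmem : v ∈ convexHull ℝ (Set.univ.pi fun i : Fin (n + 1) =>
      ({h * (⌊v i / h⌋ : ℝ), h * (⌈v i / h⌉ : ℝ)} : Set ℝ)) := by
    rw [convexHull_pi]
    intro i _
    simp only [convexHull_pair]
    rw [segment_eq_Icc ((hlo i).trans (hhi i))]
    exact ⟨hlo i, hhi i⟩
  refine convexHull_mono ?_ hmem
  intro u hu
  have hu' : ∀ i, u i = h * (⌊v i / h⌋ : ℝ) ∨ u i = h * (⌈v i / h⌉ : ℝ) := fun i => by
    simpa using hu i (Set.mem_univ i)
  refine ⟨⟨(mem_neigh_cube_iff hh.le).2 fun i => ?_, v, hv, fun i _ => ?_⟩, fun i => ?_⟩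
  · rw [hN, abs_le]
    have := hlo i; have := hhi i; have := hloN i; have := hhiN i
    rcases hu' i with e | e <;> rw [e] <;> constructor <;> linarith
  · rw [abs_le]
    have := hlo i; have := hhi i; have := hlo' i; have := hhi' i
    rcases hu' i with e | e <;> rw [e] <;> constructor <;> linarith
  · rcases hu' i with e | e
    exacts [⟨_, e⟩, ⟨_, e⟩]

section Cells

/-- The lower end of the `t`-th of the intervals of length `h` subdividing
`[-(1 / 2 + h), 1 / 2 + h]`. -/
noncomputable def cellLo (h : ℝ) (t : ℕ) : ℝ := -(1 / 2 + h) + h * t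

/-- The cell `z` (in the coordinates `J`) meets the projection of `X`. -/
def CellMeets {n N : ℕ} (h : ℝ) (J : Finset (Fin (n + 1))) (X : Set (Fin (n + 1) → ℝ))
    (z : J → Fin N) : Prop :=
  ∃ v ∈ X, ∀ i : J, cellLo h (z i) ≤ v i ∧ v i ≤ cellLo h (z i) + h

/-- Vectors in `neigh_h(B)` projecting to a vertex of one of the cells in `C`. -/
def cellVertices {n N : ℕ} (h : ℝ) (J : Finset (Fin (n + 1))) (C : Set (J → Fin N)) :
    Set (Fin (n + 1) → ℝ) :=
  {u | u ∈ neigh h (cube n) ∧ ∃ z ∈ C, ∀ i : J, u i = cellLo h (z i) ∨ u i = cellLo h (z i) + h}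

/-- A grid coordinate at distance at most `h` from `v` is an end of a subdivision interval
containing `v`. -/
theorem exists_cellLo {h : ℝ} (hh : 0 < h) {N : ℕ} (hN : 1 / 2 + h = h * N) {u v : ℝ}
    (hu : |u| ≤ 1 / 2 + h) (hv : |v| ≤ 1 / 2 + h) (huv : |u - v| ≤ h)
    (hgrid : ∃ k : ℤ, u = h * k) :
    ∃ t : Fin (2 * N), (cellLo h t ≤ v ∧ v ≤ cellLo h t + h) ∧
      (u = cellLo h t ∨ u = cellLo h t + h) := by
  obtain ⟨k, rfl⟩ := hgrid
  rw [abs_le] at hu hv huv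
  rw [hN] at hu hv
  have hk1 : -(N : ℤ) ≤ k := by
    have : -(N : ℝ) ≤ k := le_of_mul_le_mul_left (by linarith [hu.1]) hh
    exact_mod_cast this
  have hk2 : k ≤ (N : ℤ) := by
    have : (k : ℝ) ≤ N := le_of_mul_le_mul_left (by linarith [hu.2]) hh
    exact_mod_cast this
  have hN0 : 0 < N := by
    rcases Nat.eq_zero_or_pos N with h0 | h0
    · rw [h0] at hN; norm_num at hN; linarith
    · exact h0
  have left : ∀ t : ℕ, (t : ℤ) = k + N → t < 2 * N → h * (k : ℝ) ≤ v →
      ∃ t : Fin (2 * N), (cellLo h t ≤ v ∧ v ≤ cellLo h t + h) ∧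
        (h * (k : ℝ) = cellLo h t ∨ h * (k : ℝ) = cellLo h t + h) := by
    intro t ht htN hkv
    have e : cellLo h t = h * k := by
      have : (t : ℝ) = k + N := by exact_mod_cast ht
      rw [cellLo, hN, this]; ring
    exact ⟨⟨t, htN⟩, by simp only [e]; constructor <;> linarith, by simp [e]⟩
  have right : ∀ t : ℕ, (t : ℤ) + 1 = k + N → t < 2 * N → v ≤ h * (k : ℝ) →
      ∃ t : Fin (2 * N), (cellLo h t ≤ v ∧ v ≤ cellLo h t + h) ∧
        (h * (k : ℝ) = cellLo h t ∨ h * (k : ℝ) = cellLo h t + h) := by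
    intro t ht htN hkv
    have e : cellLo h t + h = h * k := by
      have : (t : ℝ) = k + N - 1 := by
        have : (t : ℝ) + 1 = k + N := by exact_mod_cast ht
        linarith
      rw [cellLo, hN, this]; ring
    exact ⟨⟨t, htN⟩, by simp only; constructor <;> linarith, by simp [e]⟩
  rcases le_total v (h * k) with hle | hle
  · rcases eq_or_lt_of_le hk1 with heq | hlt
    · refine left 0 (by omega) (by omega) ?_
      rw [← heq]; push_cast; linarith [hv.1]
    · exact right (k + N - 1).toNat (by omega) (by omega) hle
  · rcases eq_or_lt_of_le hk2 with heq | hlt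
    · refine right (2 * N - 1) (by omega) (by omega) ?_
      rw [heq]; push_cast; linarith [hv.2]
    · exact left (k + N).toNat (by omega) (by omega) hle

theorem neighI_inter_grid {n : ℕ} {h : ℝ} (hh : 0 < h) {N : ℕ} (hN : 1 / 2 + h = h * N)
    (J : Finset (Fin (n + 1))) {X : Set (Fin (n + 1) → ℝ)} (hX : X ⊆ neigh h (cube n)) :
    neighI h J X ∩ grid n h =
      cellVertices h J {z : J → Fin (2 * N) | CellMeets h J X z} ∩ grid n h := by
  ext u
  constructor
  · rintro ⟨⟨hu, v, hv, huv⟩, hg⟩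
    have h1 := (mem_neigh_cube_iff hh.le).1 hu
    have h2 := (mem_neigh_cube_iff hh.le).1 (hX hv)
    choose z hz using fun i : J => exists_cellLo hh hN (h1 i) (h2 i) (huv i i.2) (hg i)
    exact ⟨⟨hu, z, ⟨v, hv, fun i => (hz i).1⟩, fun i => (hz i).2⟩, hg⟩
  · rintro ⟨⟨hu, z, ⟨v, hv, hvz⟩, huz⟩, hg⟩
    refine ⟨⟨hu, v, hv, fun i hi => ?_⟩, hg⟩
    have h1 := hvz ⟨i, hi⟩
    have h2 := huz ⟨i, hi⟩
    simp only at h1 h2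
    rw [abs_le]
    rcases h2 with e | e <;> rw [e] <;> constructor <;> linarith [h1.1, h1.2]

theorem CellMeets.mono {n N : ℕ} {h : ℝ} {J : Finset (Fin (n + 1))}
    {X Y : Set (Fin (n + 1) → ℝ)} (hXY : X ⊆ Y) {z : J → Fin N} (hz : CellMeets h J X z) :
    CellMeets h J Y z := by
  obtain ⟨v, hv, h'⟩ := hz
  exact ⟨v, hXY hv, h'⟩

end Cells

theorem exists_le_card_eq_succ_of_antitone {α : Type*} [Fintype α] {f : ℕ → Finset α}
    (hf : ∀ k, f (k + 1) ⊆ f k) : ∃ K ≤ Fintype.card α, f (K + 1) = f K := by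
  by_contra! hne
  have key : ∀ k ≤ Fintype.card α + 1, (f k).card + k ≤ Fintype.card α := by
    intro k
    induction k with
    | zero => intro _; simpa using card_le_univ (f 0)
    | succ k ih =>
      intro hk
      have h1 := card_lt_card ((hf k).ssubset_of_ne (hne k (by omega)))
      have h2 := ih (by omega)
      omega
  have := key _ le_rfl
  omega

section Counting

variable {S : Type*} {n c lam : ℕ}

/-- Every remembered state contributes at most `c - 1` acting players besides the principal. -/
theorem card_metaI_le {I : S → Finset (Fin (n + 1))} (hcard : ∀ s, (I s).card ≤ c)
    (h0 : ∀ s, (0 : Fin (n + 1)) ∈ I s) (x : (Fin lam → Option S) × S) :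
    (metaI I x).card ≤ c + ∑ j, (x.1 j).elim 0 fun _ => c - 1 := by
  have hsub : metaI I x ⊆
      I x.2 ∪ univ.biUnion fun j : Fin lam => ((x.1 j).elim ∅ I).erase 0 := by
    intro i hi
    simp only [metaI, mem_union, mem_biUnion, mem_univ, true_and, mem_erase] at hi ⊢
    by_cases hi0 : i = 0
    · exact Or.inl (hi0 ▸ h0 _)
    · exact hi.imp_right fun ⟨j, hj⟩ => ⟨j, hi0, hj⟩
  refine (card_le_card hsub).trans ((card_union_le _ _).trans (add_le_add (hcard _) ?_))
  refine card_biUnion_le.trans (sum_le_sum fun j _ => ?_)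
  cases hj : x.1 j with
  | none => simp
  | some s =>
    simp only [Option.elim]
    rw [card_erase_of_mem (h0 s)]
    exact Nat.sub_le_sub_right (hcard s) 1

theorem sum_pow_card_metaI_le [Fintype S] {I : S → Finset (Fin (n + 1))}
    (hcard : ∀ s, (I s).card ≤ c) (h0 : ∀ s, (0 : Fin (n + 1)) ∈ I s) {M : ℕ} (hM : 2 ≤ M) :
    ∑ x : (Fin lam → Option S) × S, M ^ (metaI I x).card ≤
      Fintype.card S ^ (lam + 1) * M ^ ((lam + 1) * c) := by
  rcases isEmpty_or_nonempty S with hS | ⟨⟨s₀⟩⟩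
  · simp
  have hc : 1 ≤ c := Nat.le_trans (card_pos.2 ⟨0, h0 s₀⟩) (hcard s₀)
  have hS : 1 ≤ Fintype.card S := Fintype.card_pos_iff.2 ⟨s₀⟩
  calc ∑ x : (Fin lam → Option S) × S, M ^ (metaI I x).card
      ≤ ∑ x : (Fin lam → Option S) × S,
          M ^ c * ∏ j, M ^ ((x.1 j).elim 0 fun _ => c - 1) := by
        refine sum_le_sum fun x _ => ?_
        rw [prod_pow_eq_pow_sum, ← pow_add]
        exact Nat.pow_le_pow_right (by omega) (card_metaI_le hcard h0 x)
    _ = Fintype.card S * M ^ c * (1 + Fintype.card S * M ^ (c - 1)) ^ lam := by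
        rw [Fintype.sum_prod_type]
        simp only [sum_const, card_univ, smul_eq_mul]
        rw [← mul_sum, ← mul_sum]
        have : ∑ m : Fin lam → Option S, ∏ j, M ^ ((m j).elim 0 fun _ => c - 1)
            = (1 + Fintype.card S * M ^ (c - 1)) ^ lam := by
          have h := Finset.prod_univ_sum (fun _ : Fin lam => (univ : Finset (Option S)))
            (fun _ o => M ^ (o.elim 0 fun _ => c - 1))
          rw [Fintype.piFinset_univ] at h
          rw [← h]
          simp [Fintype.sum_option]
        rw [this, mul_assoc]
    _ ≤ Fintype.card S * M ^ c * (Fintype.card S * M ^ c) ^ lam := by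
        refine Nat.mul_le_mul_left _ (Nat.pow_le_pow_left ?_ _)
        obtain ⟨d, rfl⟩ := Nat.exists_eq_add_of_le' hc
        rw [Nat.add_sub_cancel, pow_succ]
        have : 1 ≤ M ^ d := Nat.one_le_pow _ _ (by omega)
        have h1 : 1 ≤ Fintype.card S * M ^ d := Nat.mul_pos hS this
        nlinarith
    _ = Fintype.card S ^ (lam + 1) * M ^ ((lam + 1) * c) := by
        rw [mul_comm (lam + 1) c, pow_mul, ← mul_pow, pow_succ']

end Counting

theorem Phi_subset_neigh_cube {S A : Type*} [Fintype S] [Fintype A] [DecidableEq A] {n : ℕ}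
    {G : Game S A n} (hG : G.Valid) {h : ℝ} (hh : 0 ≤ h) {VS : S → Set (Fin (n + 1) → ℝ)}
    (hVS : ∀ s, VS s ⊆ neigh h (cube n)) (s : S) : Phi G VS s ⊆ neigh h (cube n) := by
  rintro v ⟨pb, w, ⟨hpb, -, hw⟩, rfl⟩
  refine (mem_neigh_cube_iff hh).2 fun j => hpb.abs_sum_le fun a => ?_
  refine (hG.abs_lookahead_le s a j fun s' =>
    (mem_neigh_cube_iff hh).1 (hVS s' (hw a a s')) j).trans ?_
  have := mul_le_of_le_one_left hh hG.2.1.le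
  linarith

theorem PhiTB_mono {S A : Type*} [Fintype S] [Fintype A] [DecidableEq S] [DecidableEq A]
    {n : ℕ} (G : Game S A n) (lam : ℕ) (I : S → Finset (Fin (n + 1))) (ξ : ℝ)
    {VS VS' : ((Fin lam → Option S) × S) → Set (Fin (n + 1) → ℝ)}
    (h : ∀ x, VS x ⊆ VS' x) (x : (Fin lam → Option S) × S) :
    PhiTB G lam I ξ VS x ⊆ PhiTB G lam I ξ VS' x :=
  convexHull_mono (Set.inter_subset_inter_left _ (neighI_mono (Phi_mono h x)))

theorem PhiTB_subset_neigh_cube {S A : Type*} [Fintype S] [Fintype A] [DecidableEq S]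
    [DecidableEq A] {n : ℕ} (G : Game S A n) (lam : ℕ) (I : S → Finset (Fin (n + 1))) {ξ : ℝ}
    (hξ : 0 ≤ ξ) (VS : ((Fin lam → Option S) × S) → Set (Fin (n + 1) → ℝ))
    (x : (Fin lam → Option S) × S) : PhiTB G lam I ξ VS x ⊆ neigh (ξ / 2) (cube n) :=
  convexHull_min (fun _ hu => hu.1.1) (convex_neigh_cube (by positivity))

/-- Lemma 5.2: in the `λ`-memory meta-game of a
`c`-turn-based game, value-set iteration with `Φ^TB` started from
`neigh_{ξ/2}(B)` is decreasing, terminates within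
`|S|^{λ+1}·(2/ξ + 2)^{(λ+1)·c}` iterations at a fixed point of `Φ^TB` that
contains the inducible value set `𝒱*` of the meta-game. -/
theorem stmt18 {S A : Type*} [Fintype S] [Fintype A] [DecidableEq S]
    [DecidableEq A] {n c : ℕ}
    (G : Game S A n) (hG : G.Valid) (hγpos : 0 < G.gamma)
    (I : S → Finset (Fin (n + 1))) (hTB : TurnBased G c I)
    (ε δ ξ : ℝ) (hε : 0 < ε) (hδ : 0 < δ)
    (hξ : ξ = (1 - G.gamma) * min ε (δ / 2))
    (hdiv : ∃ m : ℕ, (1 / 2 : ℝ) = (m : ℝ) * ξ)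
    (lam : ℕ) (hlam : (1 + ξ) * G.gamma ^ lam < ξ / 2)
    (Vseq : ℕ → ((Fin lam → Option S) × S) → Set (Fin (n + 1) → ℝ))
    (h0 : ∀ x, Vseq 0 x = neigh (ξ / 2) (cube n))
    (hsucc : ∀ k, Vseq (k + 1) = PhiTB G lam I ξ (Vseq k)) :
    (∀ k x, Vseq (k + 1) x ⊆ Vseq k x) ∧
    ∃ K : ℕ,
      (K : ℝ) ≤ (Fintype.card S : ℝ) ^ (lam + 1) * (2 / ξ + 2) ^ ((lam + 1) * c) ∧
      Vseq (K + 1) = Vseq K ∧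
      (∀ x, Vseq K x = PhiTB G lam I ξ (Vseq K) x) ∧
      ∀ x, Vstar (metaGame G lam) x ⊆ Vseq K x := by
  classical
  have hξ0 : 0 < ξ := hξ ▸ mul_pos (by linarith [hG.2.1]) (lt_min hε (by linarith))
  obtain ⟨m, hm⟩ := hdiv
  have hh : 0 < ξ / 2 := by linarith
  have hN : 1 / 2 + ξ / 2 = ξ / 2 * ((2 * m + 1 : ℕ) : ℝ) := by push_cast; linarith
  have hGm := metaGame_valid hG lam
  have hbox : ∀ k x, Vseq k x ⊆ neigh (ξ / 2) (cube n) := by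
    rintro (_ | k) x
    · rw [h0]
    · rw [hsucc]; exact PhiTB_subset_neigh_cube G lam I hξ0.le _ x
  have hdec : ∀ k x, Vseq (k + 1) x ⊆ Vseq k x := by
    intro k
    induction k with
    | zero => intro x; rw [h0]; exact hbox 1 x
    | succ k ih =>
      intro x
      have := PhiTB_mono G lam I ξ ih x
      rwa [← hsucc, ← hsucc] at this
  have hstar : ∀ k x, Vstar (metaGame G lam) x ⊆ Vseq k x := by
    intro k
    induction k with
    | zero =>
      intro x
      rw [h0]
      exact fun v hv => ⟨v, Vstar_subset_cube hGm x hv, fun i => by simpa using hh.le⟩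
    | succ k ih =>
      intro x
      rw [hsucc]
      refine (subset_convexHull_neighI_grid hh hN (metaI I x)
        fun v hv => ⟨v, Vstar_subset_cube hGm x hv, fun i => by simpa using hh.le⟩).trans
        (convexHull_mono (Set.inter_subset_inter_left _ (neighI_mono ?_)))
      exact (Vstar_subset_Phi _ x).trans (Phi_mono ih x)
  refine ⟨hdec, ?_⟩
  -- `X k x` is the set whose relaxed grid neighborhood generates `Vseq k x`.
  let X : ℕ → ((Fin lam → Option S) × S) → Set (Fin (n + 1) → ℝ) := fun k x =>
    Nat.casesOn k (neigh (ξ / 2) (cube n)) fun k => Phi (metaGame G lam) (Vseq k) x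
  have hXbox : ∀ k x, X k x ⊆ neigh (ξ / 2) (cube n) := by
    rintro (_ | k) x
    · exact subset_rfl
    · exact Phi_subset_neigh_cube hGm hh.le (hbox k) x
  have hXdec : ∀ k x, X (k + 1) x ⊆ X k x := by
    rintro (_ | k) x
    · exact hXbox 1 x
    · exact Phi_mono (hdec k) x
  have hVX : ∀ k x, Vseq k x =
      convexHull ℝ (neighI (ξ / 2) (metaI I x) (X k x) ∩ grid n (ξ / 2)) := by
    rintro (_ | k) x
    · rw [h0]
      exact (subset_convexHull_neighI_grid hh hN _ subset_rfl).antisymm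
        (convexHull_min (fun _ hu => hu.1.1) (convex_neigh_cube hh.le))
    · rw [hsucc]; rfl
  let C : ℕ → Finset (Σ x : (Fin lam → Option S) × S, metaI I x → Fin (2 * (2 * m + 1))) :=
    fun k => univ.filter fun z => CellMeets (ξ / 2) (metaI I z.1) (X k z.1) z.2
  have hCdec : ∀ k, C (k + 1) ⊆ C k := by
    intro k z hz
    simp only [C, mem_filter, mem_univ, true_and] at hz ⊢
    exact hz.mono (hXdec k z.1)
  obtain ⟨K, hK, hCK⟩ := exists_le_card_eq_succ_of_antitone hCdec
  have hfix : Vseq (K + 1) = Vseq K := by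
    funext x
    rw [hVX, hVX, neighI_inter_grid hh hN _ (hXbox (K + 1) x),
      neighI_inter_grid hh hN _ (hXbox K x)]
    congr 4
    ext z
    have : (⟨x, z⟩ : Σ x : (Fin lam → Option S) × S, metaI I x → Fin (2 * (2 * m + 1)))
        ∈ C (K + 1) ↔ ⟨x, z⟩ ∈ C K := by rw [hCK]
    simpa [C] using this
  refine ⟨K, ?_, hfix, fun x => ?_, hstar K⟩
  · have hcount : K ≤ Fintype.card S ^ (lam + 1) *
        (2 * (2 * m + 1)) ^ ((lam + 1) * c) := by
      refine hK.trans (le_trans (le_of_eq ?_)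
        (sum_pow_card_metaI_le (lam := lam) hTB.1 hTB.2.1 (M := 2 * (2 * m + 1)) (by omega)))
      simp [Fintype.card_sigma]
    have hM : 2 / ξ + 2 = ((2 * (2 * m + 1) : ℕ) : ℝ) := by
      push_cast
      field_simp
      linarith
    rw [hM]
    exact_mod_cast hcount
  · rw [← hsucc, hfix]
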